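/- For any family D of (2D→011)-PI kernels of size (n0,n1)×p2 and any family E of (011→2D)-PI kernels of size p2×(m0,m1), there exists a family R of 011-PI kernels of size (n0,n1)×(m0,m1) such that for every triple (v, u1, u2) with v ∈ ℝ^{m0} and continuous u1 : [a,b] → ℝ^{m1}, u2 : [c,d] → ℝ^{m1}, P[D](P[E](v,u1,u2)) = P[R](v,u1,u2) (an equality of triples, holding pointwise in each component). That is, the composition of a (011→2D)-PI operator followed by a (2D→011)-PI operator is a 011-PI operator. -/

import Mathlib

open Matrix MeasureTheory Set

noncomputable section

/-- A family of 1D-PI kernels of size `p × r` (the parameters of a 1D-PI operator). -/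
structure PI1DK (p r : ℕ) where
  k0 : ℝ → Matrix (Fin p) (Fin r) ℝ
  k1 : ℝ → ℝ → Matrix (Fin p) (Fin r) ℝ
  k2 : ℝ → ℝ → Matrix (Fin p) (Fin r) ℝ

/-- Continuity of a family of 1D-PI kernels on the interval `[s,t]`. -/
def PI1DK.IsCont {p r : ℕ} (s t : ℝ) (N : PI1DK p r) : Prop :=
  ContinuousOn N.k0 (Icc s t) ∧
  ContinuousOn (fun q : ℝ × ℝ => N.k1 q.1 q.2) (Icc s t ×ˢ Icc s t) ∧
  ContinuousOn (fun q : ℝ × ℝ => N.k2 q.1 q.2) (Icc s t ×ˢ Icc s t)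

/-- The 1D-PI operator on `[s,t]` associated with the kernels `N`. -/
def PI1D {p r : ℕ} (s t : ℝ) (N : PI1DK p r) (u : ℝ → Fin r → ℝ) (x : ℝ) :
    Fin p → ℝ :=
  N.k0 x *ᵥ u x + (∫ θ in s..x, N.k1 x θ *ᵥ u θ) + (∫ θ in x..t, N.k2 x θ *ᵥ u θ)

/-- Entrywise interval integral of a matrix-valued function. -/
def mInt {p r : ℕ} (s t : ℝ) (F : ℝ → Matrix (Fin p) (Fin r) ℝ) :
    Matrix (Fin p) (Fin r) ℝ :=
  Matrix.of fun i j => ∫ η in s..t, F η i j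

/-- A family of 2D-PI kernels of size `p × r`. -/
structure PI2DK (p r : ℕ) where
  k00 : ℝ → ℝ → Matrix (Fin p) (Fin r) ℝ
  k10 : ℝ → ℝ → ℝ → Matrix (Fin p) (Fin r) ℝ
  k20 : ℝ → ℝ → ℝ → Matrix (Fin p) (Fin r) ℝ
  k01 : ℝ → ℝ → ℝ → Matrix (Fin p) (Fin r) ℝ
  k02 : ℝ → ℝ → ℝ → Matrix (Fin p) (Fin r) ℝ
  k11 : ℝ → ℝ → ℝ → ℝ → Matrix (Fin p) (Fin r) ℝ
  k21 : ℝ → ℝ → ℝ → ℝ → Matrix (Fin p) (Fin r) ℝ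
  k12 : ℝ → ℝ → ℝ → ℝ → Matrix (Fin p) (Fin r) ℝ
  k22 : ℝ → ℝ → ℝ → ℝ → Matrix (Fin p) (Fin r) ℝ

/-- Continuity of a family of 2D-PI kernels on `[a,b] × [c,d]`. -/
def PI2DK.IsCont {p r : ℕ} (a b c d : ℝ) (N : PI2DK p r) : Prop :=
  ContinuousOn (fun q : ℝ × ℝ => N.k00 q.1 q.2) (Icc a b ×ˢ Icc c d) ∧
  ContinuousOn (fun q : ℝ × ℝ × ℝ => N.k10 q.1 q.2.1 q.2.2)
    (Icc a b ×ˢ Icc c d ×ˢ Icc a b) ∧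
  ContinuousOn (fun q : ℝ × ℝ × ℝ => N.k20 q.1 q.2.1 q.2.2)
    (Icc a b ×ˢ Icc c d ×ˢ Icc a b) ∧
  ContinuousOn (fun q : ℝ × ℝ × ℝ => N.k01 q.1 q.2.1 q.2.2)
    (Icc a b ×ˢ Icc c d ×ˢ Icc c d) ∧
  ContinuousOn (fun q : ℝ × ℝ × ℝ => N.k02 q.1 q.2.1 q.2.2)
    (Icc a b ×ˢ Icc c d ×ˢ Icc c d) ∧
  ContinuousOn (fun q : ℝ × ℝ × ℝ × ℝ => N.k11 q.1 q.2.1 q.2.2.1 q.2.2.2)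
    (Icc a b ×ˢ Icc c d ×ˢ Icc a b ×ˢ Icc c d) ∧
  ContinuousOn (fun q : ℝ × ℝ × ℝ × ℝ => N.k21 q.1 q.2.1 q.2.2.1 q.2.2.2)
    (Icc a b ×ˢ Icc c d ×ˢ Icc a b ×ˢ Icc c d) ∧
  ContinuousOn (fun q : ℝ × ℝ × ℝ × ℝ => N.k12 q.1 q.2.1 q.2.2.1 q.2.2.2)
    (Icc a b ×ˢ Icc c d ×ˢ Icc a b ×ˢ Icc c d) ∧
  ContinuousOn (fun q : ℝ × ℝ × ℝ × ℝ => N.k22 q.1 q.2.1 q.2.2.1 q.2.2.2)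
    (Icc a b ×ˢ Icc c d ×ˢ Icc a b ×ˢ Icc c d)

/-- The 2D-PI operator on `[a,b] × [c,d]` associated with the kernels `N`. -/
def PI2D {p r : ℕ} (a b c d : ℝ) (N : PI2DK p r) (u : ℝ → ℝ → Fin r → ℝ)
    (x y : ℝ) : Fin p → ℝ :=
  N.k00 x y *ᵥ u x y
  + (∫ θ in a..x, N.k10 x y θ *ᵥ u θ y)
  + (∫ θ in x..b, N.k20 x y θ *ᵥ u θ y)
  + (∫ ν in c..y, N.k01 x y ν *ᵥ u x ν)
  + (∫ ν in y..d, N.k02 x y ν *ᵥ u x ν)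
  + (∫ θ in a..x, ∫ ν in c..y, N.k11 x y θ ν *ᵥ u θ ν)
  + (∫ θ in x..b, ∫ ν in c..y, N.k21 x y θ ν *ᵥ u θ ν)
  + (∫ θ in a..x, ∫ ν in y..d, N.k12 x y θ ν *ᵥ u θ ν)
  + (∫ θ in x..b, ∫ ν in y..d, N.k22 x y θ ν *ᵥ u θ ν)

/-- A family of 011-PI kernels of size `(p0,p1) × (r0,r1)`. -/
structure PI011K (p0 p1 r0 r1 : ℕ) where
  b00 : Matrix (Fin p0) (Fin r0) ℝ
  b01 : ℝ → Matrix (Fin p0) (Fin r1) ℝ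
  b02 : ℝ → Matrix (Fin p0) (Fin r1) ℝ
  b10 : ℝ → Matrix (Fin p1) (Fin r0) ℝ
  b20 : ℝ → Matrix (Fin p1) (Fin r0) ℝ
  b12 : ℝ → ℝ → Matrix (Fin p1) (Fin r1) ℝ
  b21 : ℝ → ℝ → Matrix (Fin p1) (Fin r1) ℝ
  b11 : PI1DK p1 r1
  b22 : PI1DK p1 r1

/-- Continuity of a family of 011-PI kernels. -/
def PI011K.IsCont {p0 p1 r0 r1 : ℕ} (a b c d : ℝ) (B : PI011K p0 p1 r0 r1) : Prop :=
  ContinuousOn B.b01 (Icc a b) ∧ ContinuousOn B.b02 (Icc c d) ∧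
  ContinuousOn B.b10 (Icc a b) ∧ ContinuousOn B.b20 (Icc c d) ∧
  ContinuousOn (fun q : ℝ × ℝ => B.b12 q.1 q.2) (Icc a b ×ˢ Icc c d) ∧
  ContinuousOn (fun q : ℝ × ℝ => B.b21 q.1 q.2) (Icc c d ×ˢ Icc a b) ∧
  B.b11.IsCont a b ∧ B.b22.IsCont c d

/-- The 011-PI operator associated with the kernels `B`. -/
def PI011 {p0 p1 r0 r1 : ℕ} (a b c d : ℝ) (B : PI011K p0 p1 r0 r1)
    (v : Fin r0 → ℝ) (u1 u2 : ℝ → Fin r1 → ℝ) :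
    (Fin p0 → ℝ) × (ℝ → Fin p1 → ℝ) × (ℝ → Fin p1 → ℝ) :=
  ( B.b00 *ᵥ v + (∫ θ in a..b, B.b01 θ *ᵥ u1 θ) + (∫ ν in c..d, B.b02 ν *ᵥ u2 ν),
    fun x => B.b10 x *ᵥ v + PI1D a b B.b11 u1 x + (∫ ν in c..d, B.b12 x ν *ᵥ u2 ν),
    fun y => B.b20 y *ᵥ v + (∫ θ in a..b, B.b21 y θ *ᵥ u1 θ) + PI1D c d B.b22 u2 y )

/-- A family of (2D→011)-PI kernels of size `(p0,p1) × r`. -/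
structure PI2Dto011K (p0 p1 r : ℕ) where
  d0 : ℝ → ℝ → Matrix (Fin p0) (Fin r) ℝ
  d10 : ℝ → ℝ → Matrix (Fin p1) (Fin r) ℝ
  d11 : ℝ → ℝ → ℝ → Matrix (Fin p1) (Fin r) ℝ
  d12 : ℝ → ℝ → ℝ → Matrix (Fin p1) (Fin r) ℝ
  d20 : ℝ → ℝ → Matrix (Fin p1) (Fin r) ℝ
  d21 : ℝ → ℝ → ℝ → Matrix (Fin p1) (Fin r) ℝ
  d22 : ℝ → ℝ → ℝ → Matrix (Fin p1) (Fin r) ℝ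

/-- Continuity of a family of (2D→011)-PI kernels. -/
def PI2Dto011K.IsCont {p0 p1 r : ℕ} (a b c d : ℝ) (D : PI2Dto011K p0 p1 r) : Prop :=
  ContinuousOn (fun q : ℝ × ℝ => D.d0 q.1 q.2) (Icc a b ×ˢ Icc c d) ∧
  ContinuousOn (fun q : ℝ × ℝ => D.d10 q.1 q.2) (Icc a b ×ˢ Icc c d) ∧
  ContinuousOn (fun q : ℝ × ℝ × ℝ => D.d11 q.1 q.2.1 q.2.2)
    (Icc a b ×ˢ Icc c d ×ˢ Icc a b) ∧
  ContinuousOn (fun q : ℝ × ℝ × ℝ => D.d12 q.1 q.2.1 q.2.2)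
    (Icc a b ×ˢ Icc c d ×ˢ Icc a b) ∧
  ContinuousOn (fun q : ℝ × ℝ => D.d20 q.1 q.2) (Icc a b ×ˢ Icc c d) ∧
  ContinuousOn (fun q : ℝ × ℝ × ℝ => D.d21 q.1 q.2.1 q.2.2)
    (Icc a b ×ˢ Icc c d ×ˢ Icc c d) ∧
  ContinuousOn (fun q : ℝ × ℝ × ℝ => D.d22 q.1 q.2.1 q.2.2)
    (Icc a b ×ˢ Icc c d ×ˢ Icc c d)

/-- The (2D→011)-PI operator associated with the kernels `D`. -/
def PI2Dto011 {p0 p1 r : ℕ} (a b c d : ℝ) (D : PI2Dto011K p0 p1 r)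
    (u : ℝ → ℝ → Fin r → ℝ) :
    (Fin p0 → ℝ) × (ℝ → Fin p1 → ℝ) × (ℝ → Fin p1 → ℝ) :=
  ( ∫ θ in a..b, ∫ ν in c..d, D.d0 θ ν *ᵥ u θ ν,
    fun x => ∫ y in c..d,
      (D.d10 x y *ᵥ u x y + (∫ θ in a..x, D.d11 x y θ *ᵥ u θ y)
        + (∫ θ in x..b, D.d12 x y θ *ᵥ u θ y)),
    fun y => ∫ x in a..b,
      (D.d20 x y *ᵥ u x y + (∫ ν in c..y, D.d21 x y ν *ᵥ u x ν)
        + (∫ ν in y..d, D.d22 x y ν *ᵥ u x ν)) )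

/-- A family of (011→2D)-PI kernels of size `p × (r0,r1)`. -/
structure PI011to2DK (p r0 r1 : ℕ) where
  e0 : ℝ → ℝ → Matrix (Fin p) (Fin r0) ℝ
  e10 : ℝ → ℝ → Matrix (Fin p) (Fin r1) ℝ
  e11 : ℝ → ℝ → ℝ → Matrix (Fin p) (Fin r1) ℝ
  e12 : ℝ → ℝ → ℝ → Matrix (Fin p) (Fin r1) ℝ
  e20 : ℝ → ℝ → Matrix (Fin p) (Fin r1) ℝ
  e21 : ℝ → ℝ → ℝ → Matrix (Fin p) (Fin r1) ℝ
  e22 : ℝ → ℝ → ℝ → Matrix (Fin p) (Fin r1) ℝ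

/-- Continuity of a family of (011→2D)-PI kernels. -/
def PI011to2DK.IsCont {p r0 r1 : ℕ} (a b c d : ℝ) (E : PI011to2DK p r0 r1) : Prop :=
  ContinuousOn (fun q : ℝ × ℝ => E.e0 q.1 q.2) (Icc a b ×ˢ Icc c d) ∧
  ContinuousOn (fun q : ℝ × ℝ => E.e10 q.1 q.2) (Icc a b ×ˢ Icc c d) ∧
  ContinuousOn (fun q : ℝ × ℝ × ℝ => E.e11 q.1 q.2.1 q.2.2)
    (Icc a b ×ˢ Icc c d ×ˢ Icc a b) ∧
  ContinuousOn (fun q : ℝ × ℝ × ℝ => E.e12 q.1 q.2.1 q.2.2)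
    (Icc a b ×ˢ Icc c d ×ˢ Icc a b) ∧
  ContinuousOn (fun q : ℝ × ℝ => E.e20 q.1 q.2) (Icc a b ×ˢ Icc c d) ∧
  ContinuousOn (fun q : ℝ × ℝ × ℝ => E.e21 q.1 q.2.1 q.2.2)
    (Icc a b ×ˢ Icc c d ×ˢ Icc c d) ∧
  ContinuousOn (fun q : ℝ × ℝ × ℝ => E.e22 q.1 q.2.1 q.2.2)
    (Icc a b ×ˢ Icc c d ×ˢ Icc c d)

/-- The (011→2D)-PI operator associated with the kernels `E`. -/
def PI011to2D {p r0 r1 : ℕ} (a b c d : ℝ) (E : PI011to2DK p r0 r1)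
    (v : Fin r0 → ℝ) (u1 u2 : ℝ → Fin r1 → ℝ) (x y : ℝ) : Fin p → ℝ :=
  E.e0 x y *ᵥ v + E.e10 x y *ᵥ u1 x
  + (∫ θ in a..x, E.e11 x y θ *ᵥ u1 θ) + (∫ θ in x..b, E.e12 x y θ *ᵥ u1 θ)
  + E.e20 x y *ᵥ u2 y
  + (∫ ν in c..y, E.e21 x y ν *ᵥ u2 ν) + (∫ ν in y..d, E.e22 x y ν *ᵥ u2 ν)

section PartialIntegral

variable {V U F G : Type*} [NormedAddCommGroup V] [NormedSpace ℝ V]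
  [NormedAddCommGroup U] [NormedSpace ℝ U] [NormedAddCommGroup F] [NormedSpace ℝ F]
  [NormedAddCommGroup G] [NormedSpace ℝ G]

theorem continuous_intervalIntegral_of_continuous {X : Type*} [TopologicalSpace X]
    {f : X → ℝ → G} (hf : Continuous fun p : X × ℝ => f p.1 p.2) {s t : X → ℝ}
    (hs : Continuous s) (ht : Continuous t) :
    Continuous fun x => ∫ θ in s x..t x, f x θ := by
  have h : ∀ x, ∫ θ in s x..t x, f x θ = (∫ θ in 0..t x, f x θ) - ∫ θ in 0..s x, f x θ := by
    intro x
    have hx : Continuous (f x) := hf.comp (Continuous.prodMk_right x)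
    rw [intervalIntegral.integral_interval_sub_left] <;> exact hx.intervalIntegrable _ _
  simp_rw [h]
  exact (intervalIntegral.continuous_parametric_intervalIntegral_of_continuous hf ht).sub
    (intervalIntegral.continuous_parametric_intervalIntegral_of_continuous hf hs)

theorem integral_integral_swap_of_continuous {f : ℝ × ℝ → G} (hf : Continuous f)
    (a b c d : ℝ) :
    ∫ x in a..b, ∫ y in c..d, f (x, y) = ∫ y in c..d, ∫ x in a..b, f (x, y) :=
  intervalIntegral_intervalIntegral_swap (F := fun x y => f (x, y)) <|
    (hf.continuousOn.integrableOn_compact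
      (isCompact_uIcc.prod isCompact_uIcc)).mono_set
      (prod_mono uIoc_subset_uIcc uIoc_subset_uIcc)

theorem integral_indicator_Ici {f : ℝ → G} {a t η : ℝ} (h : η ∈ Icc a t) :
    ∫ θ in a..t, (Ici η).indicator f θ = ∫ θ in η..t, f θ := by
  rw [intervalIntegral.integral_of_le (h.1.trans h.2), intervalIntegral.integral_of_le h.2,
    setIntegral_congr_set (Ioc_ae_eq_Icc (a := a) (b := t)),
    setIntegral_indicator measurableSet_Ici, setIntegral_congr_set (Ioc_ae_eq_Icc (a := η) (b := t))]
  congr 2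
  ext z
  simp only [mem_inter_iff, mem_Icc, mem_Ici]
  exact ⟨fun hz => ⟨hz.2, hz.1.2⟩, fun hz => ⟨⟨h.1.trans hz.1, hz.2⟩, hz.1⟩⟩

theorem integral_integral_triangle_of_le {f : ℝ × ℝ → G} (hf : Continuous f) {a t : ℝ}
    (hat : a ≤ t) :
    ∫ θ in a..t, ∫ η in a..θ, f (θ, η) = ∫ η in a..t, ∫ θ in η..t, f (θ, η) := by
  have hS : MeasurableSet {q : ℝ × ℝ | q.2 ≤ q.1} := measurableSet_le measurable_snd measurable_fst
  have hint : IntegrableOn ({q : ℝ × ℝ | q.2 ≤ q.1}.indicator f) (uIoc a t ×ˢ uIoc a t) :=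
    ((hf.continuousOn.integrableOn_compact (isCompact_uIcc.prod isCompact_uIcc)).mono_set
      (prod_mono uIoc_subset_uIcc uIoc_subset_uIcc)).indicator hS
  have hswap := intervalIntegral_intervalIntegral_swap
    (F := fun x y => {q : ℝ × ℝ | q.2 ≤ q.1}.indicator f (x, y)) hint
  calc _ = ∫ θ in a..t, ∫ η in a..t, {q : ℝ × ℝ | q.2 ≤ q.1}.indicator f (θ, η) := by
        refine intervalIntegral.integral_congr fun θ hθ => ?_
        rw [uIcc_of_le hat] at hθ
        exact (intervalIntegral.integral_indicator (f := fun η => f (θ, η)) hθ).symm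
    _ = _ := hswap
    _ = _ := by
        refine intervalIntegral.integral_congr fun η hη => ?_
        rw [uIcc_of_le hat] at hη
        exact integral_indicator_Ici (f := fun θ => f (θ, η)) hη

theorem integral_integral_triangle {f : ℝ × ℝ → G} (hf : Continuous f) (a t : ℝ) :
    ∫ θ in a..t, ∫ η in a..θ, f (θ, η) = ∫ η in a..t, ∫ θ in η..t, f (θ, η) := by
  rcases le_total a t with h | h
  · exact integral_integral_triangle_of_le hf h
  · have := integral_integral_triangle_of_le (hf.comp continuous_swap) h
    simp only [Function.comp_apply, Prod.swap_prod_mk] at this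
    rw [intervalIntegral.integral_symm t a, intervalIntegral.integral_symm t a, neg_inj]
    simp_rw [fun θ => intervalIntegral.integral_symm (μ := volume) (f := fun η => f (θ, η)) θ a,
      fun η => intervalIntegral.integral_symm (μ := volume) (f := fun θ => f (θ, η)) t η,
      intervalIntegral.integral_neg, this]

/-- The value at `x` of the partial integral operator. -/
def partialInt (a b : ℝ) (k₀ : ℝ → U →L[ℝ] G) (k₁ k₂ : ℝ × ℝ → U →L[ℝ] G) (u : ℝ → U)
    (x : ℝ) : G :=
  k₀ x (u x) + (∫ θ in a..x, k₁ (x, θ) (u θ)) + ∫ θ in a..b, k₂ (x, θ) (u θ)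

theorem continuous_partialInt {X : Type*} [TopologicalSpace X] {k₀ : X → ℝ → U →L[ℝ] G}
    {k₁ k₂ : X → ℝ × ℝ → U →L[ℝ] G} {u : ℝ → U} {y : X → ℝ}
    (h₀ : Continuous fun p : X × ℝ => k₀ p.1 p.2)
    (h₁ : Continuous fun p : X × ℝ × ℝ => k₁ p.1 p.2)
    (h₂ : Continuous fun p : X × ℝ × ℝ => k₂ p.1 p.2)
    (hu : Continuous u) (hy : Continuous y) (a b : ℝ) :
    Continuous fun x => partialInt a b (k₀ x) (k₁ x) (k₂ x) u (y x) := by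
  have c₀ : Continuous fun x => k₀ x (y x) := h₀.comp (continuous_id.prodMk hy)
  have c₁ : Continuous fun p : X × ℝ => k₁ p.1 (y p.1, p.2) :=
    h₁.comp (continuous_fst.prodMk ((hy.comp continuous_fst).prodMk continuous_snd))
  have c₂ : Continuous fun p : X × ℝ => k₂ p.1 (y p.1, p.2) :=
    h₂.comp (continuous_fst.prodMk ((hy.comp continuous_fst).prodMk continuous_snd))
  refine ((c₀.clm_apply (hu.comp hy)).add ?_).add ?_
  · exact continuous_intervalIntegral_of_continuous (c₁.clm_apply (hu.comp continuous_snd))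
      continuous_const hy
  · exact continuous_intervalIntegral_of_continuous (c₂.clm_apply (hu.comp continuous_snd))
      continuous_const continuous_const

theorem partialInt_add {k₀ l₀ : ℝ → U →L[ℝ] G} {k₁ k₂ l₁ l₂ : ℝ × ℝ → U →L[ℝ] G} {u : ℝ → U}
    (hk₁ : Continuous k₁) (hk₂ : Continuous k₂) (hl₁ : Continuous l₁) (hl₂ : Continuous l₂)
    (hu : Continuous u) (a b x : ℝ) :
    partialInt a b (fun x => k₀ x + l₀ x) (fun q => k₁ q + l₁ q) (fun q => k₂ q + l₂ q) u x =
      partialInt a b k₀ k₁ k₂ u x + partialInt a b l₀ l₁ l₂ u x := by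
  simp only [partialInt, _root_.add_apply]
  rw [intervalIntegral.integral_add, intervalIntegral.integral_add]
  · abel
  all_goals exact Continuous.intervalIntegrable (by fun_prop) _ _

theorem clm_partialInt [CompleteSpace F] [CompleteSpace G] (k : ℝ → F →L[ℝ] G)
    {e₀ : ℝ → U →L[ℝ] F} {e₁ e₂ : ℝ × ℝ → U →L[ℝ] F} {u : ℝ → U}
    (h₁ : Continuous e₁) (h₂ : Continuous e₂) (hu : Continuous u) (a b x : ℝ) :
    k x (partialInt a b e₀ e₁ e₂ u x) =
      partialInt a b (fun x => k x ∘L e₀ x) (fun q => k q.1 ∘L e₁ q) (fun q => k q.1 ∘L e₂ q)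
        u x := by
  simp only [partialInt, map_add, ContinuousLinearMap.comp_apply]
  rw [(k x).intervalIntegral_comp_comm, (k x).intervalIntegral_comp_comm]
  all_goals exact Continuous.intervalIntegrable (by fun_prop) _ _

theorem integral_clm_partialInt [CompleteSpace F] [CompleteSpace G] {k : ℝ → F →L[ℝ] G}
    {e₀ : ℝ → U →L[ℝ] F}
    {e₁ e₂ : ℝ × ℝ → U →L[ℝ] F} {u : ℝ → U} (hk : Continuous k) (h₀ : Continuous e₀)
    (h₁ : Continuous e₁) (h₂ : Continuous e₂) (hu : Continuous u) (a b t : ℝ) :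
    ∫ θ in a..t, k θ (partialInt a b e₀ e₁ e₂ u θ) =
      (∫ θ in a..t, (k θ ∘L e₀ θ + ∫ η in θ..t, k η ∘L e₁ (η, θ)) (u θ)) +
        ∫ η in a..b, (∫ θ in a..t, k θ ∘L e₂ (θ, η)) (u η) := by
  have c₁ : Continuous fun θ => ∫ η in a..θ, e₁ (θ, η) (u η) :=
    continuous_intervalIntegral_of_continuous (by fun_prop) (by fun_prop) (by fun_prop)
  have c₂ : Continuous fun θ => ∫ η in a..b, e₂ (θ, η) (u η) :=
    continuous_intervalIntegral_of_continuous (by fun_prop) (by fun_prop) (by fun_prop)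
  have c₃ : Continuous fun θ => ∫ η in θ..t, k η ∘L e₁ (η, θ) :=
    continuous_intervalIntegral_of_continuous (by fun_prop) (by fun_prop) (by fun_prop)
  have s₁ : ∫ θ in a..t, k θ (∫ η in a..θ, e₁ (θ, η) (u η)) =
      ∫ θ in a..t, (∫ η in θ..t, k η ∘L e₁ (η, θ)) (u θ) := by
    have e : ∀ θ, k θ (∫ η in a..θ, e₁ (θ, η) (u η)) = ∫ η in a..θ, k θ (e₁ (θ, η) (u η)) :=
      fun θ => ((k θ).intervalIntegral_comp_comm
        (Continuous.intervalIntegrable (by fun_prop) _ _)).symm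
    have e' : ∀ θ, (∫ η in θ..t, k η ∘L e₁ (η, θ)) (u θ) =
        ∫ η in θ..t, k η (e₁ (η, θ) (u θ)) := fun θ =>
      ContinuousLinearMap.intervalIntegral_apply
        (Continuous.intervalIntegrable (by fun_prop) _ _) _
    simp_rw [e, e']
    exact integral_integral_triangle (f := fun q => k q.1 (e₁ q (u q.2))) (by fun_prop) a t
  have s₂ : ∫ θ in a..t, k θ (∫ η in a..b, e₂ (θ, η) (u η)) =
      ∫ η in a..b, (∫ θ in a..t, k θ ∘L e₂ (θ, η)) (u η) := by
    have e : ∀ θ, k θ (∫ η in a..b, e₂ (θ, η) (u η)) = ∫ η in a..b, k θ (e₂ (θ, η) (u η)) :=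
      fun θ => ((k θ).intervalIntegral_comp_comm
        (Continuous.intervalIntegrable (by fun_prop) _ _)).symm
    have e' : ∀ η, (∫ θ in a..t, k θ ∘L e₂ (θ, η)) (u η) =
        ∫ θ in a..t, k θ (e₂ (θ, η) (u η)) := fun η =>
      ContinuousLinearMap.intervalIntegral_apply
        (Continuous.intervalIntegrable (by fun_prop) _ _) _
    simp_rw [e, e']
    exact integral_integral_swap_of_continuous (f := fun q => k q.1 (e₂ q (u q.2)))
      (by fun_prop) _ _ _ _
  simp only [partialInt, map_add, _root_.add_apply]
  rw [intervalIntegral.integral_add, intervalIntegral.integral_add,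
    intervalIntegral.integral_add (f := fun θ => (k θ ∘L e₀ θ) (u θ)), s₁, s₂]
  · rfl
  all_goals exact Continuous.intervalIntegrable (by fun_prop) _ _

/-- Operators on a variable not affected by the integration commute with it. -/
theorem integral_clm_partialInt_param [CompleteSpace F] [CompleteSpace G] {k : ℝ → F →L[ℝ] G}
    {e₀ : ℝ × ℝ → U →L[ℝ] F}
    {e₁ e₂ : ℝ × ℝ × ℝ → U →L[ℝ] F} {u : ℝ → U} (hk : Continuous k) (h₀ : Continuous e₀)
    (h₁ : Continuous e₁) (h₂ : Continuous e₂) (hu : Continuous u) (a t c d y : ℝ) :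
    ∫ θ in a..t, k θ (partialInt c d (fun y => e₀ (θ, y)) (fun q => e₁ (θ, q))
        (fun q => e₂ (θ, q)) u y) =
      partialInt c d (fun y => ∫ θ in a..t, k θ ∘L e₀ (θ, y))
        (fun q => ∫ θ in a..t, k θ ∘L e₁ (θ, q)) (fun q => ∫ θ in a..t, k θ ∘L e₂ (θ, q)) u y := by
  have key : ∀ (e : ℝ × ℝ × ℝ → U →L[ℝ] F), Continuous e → ∀ s s' : ℝ,
      ∫ θ in a..t, k θ (∫ ν in s..s', e (θ, y, ν) (u ν)) =
        ∫ ν in s..s', (∫ θ in a..t, k θ ∘L e (θ, y, ν)) (u ν) := by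
    intro e he s s'
    have e' : ∀ θ, k θ (∫ ν in s..s', e (θ, y, ν) (u ν)) =
        ∫ ν in s..s', k θ (e (θ, y, ν) (u ν)) :=
      fun θ => ((k θ).intervalIntegral_comp_comm
        (Continuous.intervalIntegrable (by fun_prop) _ _)).symm
    have e'' : ∀ ν, (∫ θ in a..t, k θ ∘L e (θ, y, ν)) (u ν) =
        ∫ θ in a..t, k θ (e (θ, y, ν) (u ν)) := fun ν =>
      ContinuousLinearMap.intervalIntegral_apply
        (Continuous.intervalIntegrable (by fun_prop) _ _) _
    simp_rw [e', e'']
    exact integral_integral_swap_of_continuous (f := fun q => k q.1 (e (q.1, y, q.2) (u q.2)))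
      (by fun_prop) _ _ _ _
  have hc : ∀ (e : ℝ × ℝ × ℝ → U →L[ℝ] F), Continuous e → ∀ s s' : ℝ,
      Continuous fun θ => ∫ ν in s..s', e (θ, y, ν) (u ν) := fun e he s s' =>
    continuous_intervalIntegral_of_continuous (by fun_prop) (by fun_prop) (by fun_prop)
  have c₁ := hc e₁ h₁ c y
  have c₂ := hc e₂ h₂ c d
  simp only [partialInt, map_add]
  rw [intervalIntegral.integral_add, intervalIntegral.integral_add, key e₁ h₁, key e₂ h₂,
    ContinuousLinearMap.intervalIntegral_apply]
  · rfl
  all_goals exact Continuous.intervalIntegrable (by fun_prop) _ _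

/-- Operators taking `(v, u₁, u₂)` to a function of two variables that are given by continuous
partial integral kernels. -/
def IsPartialInt (a b c d : ℝ) (T : V → (ℝ → U) → (ℝ → U) → ℝ → ℝ → G) : Prop :=
  ∃ (e : ℝ × ℝ → V →L[ℝ] G) (k₀ : ℝ × ℝ → U →L[ℝ] G) (k₁ k₂ : ℝ × ℝ × ℝ → U →L[ℝ] G)
    (l₀ : ℝ × ℝ → U →L[ℝ] G) (l₁ l₂ : ℝ × ℝ × ℝ → U →L[ℝ] G),
    Continuous e ∧ Continuous k₀ ∧ Continuous k₁ ∧ Continuous k₂ ∧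
    Continuous l₀ ∧ Continuous l₁ ∧ Continuous l₂ ∧
    ∀ v u₁ u₂, Continuous u₁ → Continuous u₂ → ∀ x y, T v u₁ u₂ x y = e (x, y) v +
      partialInt a b (fun x => k₀ (y, x)) (fun q => k₁ (y, q)) (fun q => k₂ (y, q)) u₁ x +
      partialInt c d (fun y => l₀ (x, y)) (fun q => l₁ (x, q)) (fun q => l₂ (x, q)) u₂ y

namespace IsPartialInt

variable {a b c d : ℝ} {T S : V → (ℝ → U) → (ℝ → U) → ℝ → ℝ → F}

theorem congr (hT : IsPartialInt a b c d T)
    (h : ∀ v u₁ u₂, Continuous u₁ → Continuous u₂ → ∀ x y, S v u₁ u₂ x y = T v u₁ u₂ x y) :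
    IsPartialInt a b c d S := by
  obtain ⟨e, k₀, k₁, k₂, l₀, l₁, l₂, he, hk₀, hk₁, hk₂, hl₀, hl₁, hl₂, hT⟩ := hT
  exact ⟨e, k₀, k₁, k₂, l₀, l₁, l₂, he, hk₀, hk₁, hk₂, hl₀, hl₁, hl₂,
    fun v u₁ u₂ h₁ h₂ x y => (h v u₁ u₂ h₁ h₂ x y).trans (hT v u₁ u₂ h₁ h₂ x y)⟩

theorem swap (hT : IsPartialInt a b c d T) :
    IsPartialInt c d a b fun v u₁ u₂ x y => T v u₂ u₁ y x := by
  obtain ⟨e, k₀, k₁, k₂, l₀, l₁, l₂, he, hk₀, hk₁, hk₂, hl₀, hl₁, hl₂, hT⟩ := hT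
  refine ⟨e ∘ Prod.swap, l₀, l₁, l₂, k₀, k₁, k₂, by fun_prop, hl₀, hl₁, hl₂, hk₀, hk₁, hk₂,
    fun v u₁ u₂ h₁ h₂ x y => ?_⟩
  simp only [hT v u₂ u₁ h₂ h₁, Function.comp_apply, Prod.swap_prod_mk]
  abel

theorem continuous (hT : IsPartialInt a b c d T) (v : V) {u₁ u₂ : ℝ → U} (h₁ : Continuous u₁)
    (h₂ : Continuous u₂) : Continuous fun q : ℝ × ℝ => T v u₁ u₂ q.1 q.2 := by
  obtain ⟨e, k₀, k₁, k₂, l₀, l₁, l₂, he, hk₀, hk₁, hk₂, hl₀, hl₁, hl₂, hT⟩ := hT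
  simp only [hT v u₁ u₂ h₁ h₂]
  refine (Continuous.add (by fun_prop) ?_).add ?_ <;>
  exact continuous_partialInt (by fun_prop) (by fun_prop) (by fun_prop) (by fun_prop)
    (by fun_prop) _ _

theorem add (hT : IsPartialInt a b c d T) (hS : IsPartialInt a b c d S) :
    IsPartialInt a b c d fun v u₁ u₂ x y => T v u₁ u₂ x y + S v u₁ u₂ x y := by
  obtain ⟨e, k₀, k₁, k₂, l₀, l₁, l₂, he, hk₀, hk₁, hk₂, hl₀, hl₁, hl₂, hT⟩ := hT
  obtain ⟨e', k₀', k₁', k₂', l₀', l₁', l₂', he', hk₀', hk₁', hk₂', hl₀', hl₁', hl₂', hS⟩ := hS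
  refine ⟨fun q => e q + e' q, fun q => k₀ q + k₀' q, fun q => k₁ q + k₁' q,
    fun q => k₂ q + k₂' q, fun q => l₀ q + l₀' q, fun q => l₁ q + l₁' q, fun q => l₂ q + l₂' q,
    by fun_prop, by fun_prop, by fun_prop, by fun_prop, by fun_prop, by fun_prop, by fun_prop,
    fun v u₁ u₂ h₁ h₂ x y => ?_⟩
  rw [partialInt_add, partialInt_add]
  · simp only [hT v u₁ u₂ h₁ h₂, hS v u₁ u₂ h₁ h₂]
    simp only [_root_.add_apply]
    abel
  all_goals fun_prop

variable [CompleteSpace F] [CompleteSpace G]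

theorem clm_apply (hT : IsPartialInt a b c d T) {K : ℝ × ℝ → F →L[ℝ] G} (hK : Continuous K) :
    IsPartialInt a b c d fun v u₁ u₂ x y => K (x, y) (T v u₁ u₂ x y) := by
  obtain ⟨e, k₀, k₁, k₂, l₀, l₁, l₂, he, hk₀, hk₁, hk₂, hl₀, hl₁, hl₂, hT⟩ := hT
  refine ⟨fun q => K q ∘L e q, fun q => K (q.2, q.1) ∘L k₀ q, fun q => K (q.2.1, q.1) ∘L k₁ q,
    fun q => K (q.2.1, q.1) ∘L k₂ q, fun q => K q ∘L l₀ q, fun q => K (q.1, q.2.1) ∘L l₁ q,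
    fun q => K (q.1, q.2.1) ∘L l₂ q,
    by fun_prop, by fun_prop, by fun_prop, by fun_prop, by fun_prop, by fun_prop, by fun_prop,
    fun v u₁ u₂ h₁ h₂ x y => ?_⟩
  simp only [hT v u₁ u₂ h₁ h₂]
  rw [map_add, map_add, clm_partialInt (fun x => K (x, y)),
    clm_partialInt (fun y => K (x, y))]
  · rfl
  all_goals fun_prop

/-- Splitting `∫ θ in a..t` of a kernel applied to a partial integral operator. -/
theorem integral_eq {e : ℝ × ℝ → V →L[ℝ] F} {k₀ : ℝ × ℝ → U →L[ℝ] F}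
    {k₁ k₂ : ℝ × ℝ × ℝ → U →L[ℝ] F}
    {l₀ : ℝ × ℝ → U →L[ℝ] F} {l₁ l₂ : ℝ × ℝ × ℝ → U →L[ℝ] F}
    (he : Continuous e) (hk₀ : Continuous k₀) (hk₁ : Continuous k₁) (hk₂ : Continuous k₂)
    (hl₀ : Continuous l₀) (hl₁ : Continuous l₁) (hl₂ : Continuous l₂)
    {K : ℝ → F →L[ℝ] G} (hK : Continuous K) (v : V) {u₁ u₂ : ℝ → U} (h₁ : Continuous u₁)
    (h₂ : Continuous u₂) (t y : ℝ) :
    ∫ θ in a..t, K θ (e (θ, y) v +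
      partialInt a b (fun x => k₀ (y, x)) (fun q => k₁ (y, q)) (fun q => k₂ (y, q)) u₁ θ +
      partialInt c d (fun y => l₀ (θ, y)) (fun q => l₁ (θ, q)) (fun q => l₂ (θ, q)) u₂ y) =
    (∫ θ in a..t, K θ ∘L e (θ, y)) v +
      ((∫ θ in a..t, (K θ ∘L k₀ (y, θ) + ∫ η in θ..t, K η ∘L k₁ (y, η, θ)) (u₁ θ)) +
        ∫ η in a..b, (∫ θ in a..t, K θ ∘L k₂ (y, θ, η)) (u₁ η)) +
      partialInt c d (fun y => ∫ θ in a..t, K θ ∘L l₀ (θ, y))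
        (fun q => ∫ θ in a..t, K θ ∘L l₁ (θ, q)) (fun q => ∫ θ in a..t, K θ ∘L l₂ (θ, q))
        u₂ y := by
  rw [← integral_clm_partialInt (e₀ := fun θ => k₀ (y, θ)) (e₁ := fun q => k₁ (y, q))
      (e₂ := fun q => k₂ (y, q)) hK (by fun_prop) (by fun_prop) (by fun_prop) h₁,
    ← integral_clm_partialInt_param hK hl₀ hl₁ hl₂ h₂,
    ContinuousLinearMap.intervalIntegral_apply (Continuous.intervalIntegrable (by fun_prop) _ _)]
  have c₁ : Continuous fun θ => partialInt a b (fun x => k₀ (y, x)) (fun q => k₁ (y, q))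
      (fun q => k₂ (y, q)) u₁ θ :=
    continuous_partialInt (by fun_prop) (by fun_prop) (by fun_prop) h₁ continuous_id _ _
  have c₂ : Continuous fun θ => partialInt c d (fun y => l₀ (θ, y)) (fun q => l₁ (θ, q))
      (fun q => l₂ (θ, q)) u₂ y :=
    continuous_partialInt (by fun_prop) (by fun_prop) (by fun_prop) h₂ continuous_const _ _
  simp only [map_add]
  rw [intervalIntegral.integral_add, intervalIntegral.integral_add]
  · rfl
  all_goals exact Continuous.intervalIntegrable (by fun_prop) _ _

theorem integral_left (hT : IsPartialInt a b c d T) {K : ℝ × ℝ × ℝ → F →L[ℝ] G}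
    (hK : Continuous K) :
    IsPartialInt a b c d fun v u₁ u₂ x y => ∫ θ in a..x, K (x, y, θ) (T v u₁ u₂ θ y) := by
  obtain ⟨e, k₀, k₁, k₂, l₀, l₁, l₂, he, hk₀, hk₁, hk₂, hl₀, hl₁, hl₂, hT⟩ := hT
  refine ⟨fun q => ∫ θ in a..q.1, K (q.1, q.2, θ) ∘L e (θ, q.2), fun _ => 0,
    fun q => K (q.2.1, q.1, q.2.2) ∘L k₀ (q.1, q.2.2) +
      ∫ η in q.2.2..q.2.1, K (q.2.1, q.1, η) ∘L k₁ (q.1, η, q.2.2),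
    fun q => ∫ θ in a..q.2.1, K (q.2.1, q.1, θ) ∘L k₂ (q.1, θ, q.2.2),
    fun q => ∫ θ in a..q.1, K (q.1, q.2, θ) ∘L l₀ (θ, q.2),
    fun q => ∫ θ in a..q.1, K (q.1, q.2.1, θ) ∘L l₁ (θ, q.2),
    fun q => ∫ θ in a..q.1, K (q.1, q.2.1, θ) ∘L l₂ (θ, q.2), ?_, ?_, ?_, ?_, ?_, ?_, ?_,
    fun v u₁ u₂ h₁ h₂ x y => ?_⟩
  rotate_right
  · simp_rw [hT v u₁ u₂ h₁ h₂]
    rw [integral_eq (K := fun θ => K (x, y, θ)) he hk₀ hk₁ hk₂ hl₀ hl₁ hl₂ (by fun_prop) v h₁ h₂]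
    simp only [partialInt, _root_.zero_apply, zero_add]
  · exact continuous_intervalIntegral_of_continuous (by fun_prop) (by fun_prop) (by fun_prop)
  · exact continuous_const
  · exact Continuous.add (by fun_prop)
      (continuous_intervalIntegral_of_continuous (by fun_prop) (by fun_prop) (by fun_prop))
  all_goals
    exact continuous_intervalIntegral_of_continuous (by fun_prop) (by fun_prop) (by fun_prop)

theorem integral_full (hT : IsPartialInt a b c d T) {K : ℝ × ℝ × ℝ → F →L[ℝ] G}
    (hK : Continuous K) :
    IsPartialInt a b c d fun v u₁ u₂ x y => ∫ θ in a..b, K (x, y, θ) (T v u₁ u₂ θ y) := by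
  obtain ⟨e, k₀, k₁, k₂, l₀, l₁, l₂, he, hk₀, hk₁, hk₂, hl₀, hl₁, hl₂, hT⟩ := hT
  refine ⟨fun q => ∫ θ in a..b, K (q.1, q.2, θ) ∘L e (θ, q.2), fun _ => 0, fun _ => 0,
    fun q => (K (q.2.1, q.1, q.2.2) ∘L k₀ (q.1, q.2.2) +
      ∫ η in q.2.2..b, K (q.2.1, q.1, η) ∘L k₁ (q.1, η, q.2.2)) +
      ∫ θ in a..b, K (q.2.1, q.1, θ) ∘L k₂ (q.1, θ, q.2.2),
    fun q => ∫ θ in a..b, K (q.1, q.2, θ) ∘L l₀ (θ, q.2),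
    fun q => ∫ θ in a..b, K (q.1, q.2.1, θ) ∘L l₁ (θ, q.2),
    fun q => ∫ θ in a..b, K (q.1, q.2.1, θ) ∘L l₂ (θ, q.2), ?_, ?_, ?_, ?_, ?_, ?_, ?_,
    fun v u₁ u₂ h₁ h₂ x y => ?_⟩
  rotate_right
  · have c₁ : Continuous fun θ => ∫ η in θ..b, K (x, y, η) ∘L k₁ (y, η, θ) :=
      continuous_intervalIntegral_of_continuous (by fun_prop) (by fun_prop) (by fun_prop)
    have c₂ : Continuous fun η => ∫ θ in a..b, K (x, y, θ) ∘L k₂ (y, θ, η) :=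
      continuous_intervalIntegral_of_continuous (by fun_prop) (by fun_prop) (by fun_prop)
    simp_rw [hT v u₁ u₂ h₁ h₂]
    rw [integral_eq (K := fun θ => K (x, y, θ)) he hk₀ hk₁ hk₂ hl₀ hl₁ hl₂ (by fun_prop) v h₁ h₂,
      ← intervalIntegral.integral_add (Continuous.intervalIntegrable (by fun_prop) _ _)
        (Continuous.intervalIntegrable (by fun_prop) _ _)]
    simp only [partialInt, _root_.zero_apply, zero_add,
      intervalIntegral.integral_zero, _root_.add_apply]
  · exact continuous_intervalIntegral_of_continuous (by fun_prop) (by fun_prop) (by fun_prop)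
  · exact continuous_const
  · exact continuous_const
  · refine (Continuous.add (by fun_prop) ?_).add ?_ <;>
    exact continuous_intervalIntegral_of_continuous (by fun_prop) (by fun_prop) (by fun_prop)
  all_goals
    exact continuous_intervalIntegral_of_continuous (by fun_prop) (by fun_prop) (by fun_prop)

theorem integral_right (hT : IsPartialInt a b c d T) {K : ℝ × ℝ × ℝ → F →L[ℝ] G}
    (hK : Continuous K) :
    IsPartialInt a b c d fun v u₁ u₂ x y => ∫ θ in x..b, K (x, y, θ) (T v u₁ u₂ θ y) := by
  refine ((hT.integral_full hK).add (hT.integral_left (K := fun q => -K q) hK.neg)).congr fun v u₁ u₂ h₁ h₂ x y => ?_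
  have hc : Continuous fun θ => K (x, y, θ) (T v u₁ u₂ θ y) :=
    Continuous.clm_apply (by fun_prop) ((hT.continuous v h₁ h₂).comp (Continuous.prodMk_left y))
  simp only [_root_.neg_apply, intervalIntegral.integral_neg]
  rw [← sub_eq_add_neg, intervalIntegral.integral_interval_sub_left] <;>
    exact hc.intervalIntegrable _ _

theorem comp_left (hT : IsPartialInt a b c d T) {K₀ : ℝ × ℝ → F →L[ℝ] G}
    {K₁ K₂ : ℝ × ℝ × ℝ → F →L[ℝ] G} (hK₀ : Continuous K₀) (hK₁ : Continuous K₁)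
    (hK₂ : Continuous K₂) :
    IsPartialInt a b c d fun v u₁ u₂ x y => K₀ (x, y) (T v u₁ u₂ x y) +
      (∫ θ in a..x, K₁ (x, y, θ) (T v u₁ u₂ θ y)) + ∫ θ in x..b, K₂ (x, y, θ) (T v u₁ u₂ θ y) :=
  ((hT.clm_apply hK₀).add (hT.integral_left hK₁)).add (hT.integral_right hK₂)

/-- Integration over the second variable. -/
theorem exists_integral_snd (hT : IsPartialInt a b c d T) :
    ∃ (e : ℝ → V →L[ℝ] F) (k₀ : ℝ → U →L[ℝ] F) (k₁ k₂ : ℝ × ℝ → U →L[ℝ] F)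
      (l : ℝ × ℝ → U →L[ℝ] F),
      Continuous e ∧ Continuous k₀ ∧ Continuous k₁ ∧ Continuous k₂ ∧ Continuous l ∧
      ∀ v u₁ u₂, Continuous u₁ → Continuous u₂ → ∀ x, ∫ y in c..d, T v u₁ u₂ x y =
        e x v + partialInt a b k₀ k₁ k₂ u₁ x + ∫ ν in c..d, l (x, ν) (u₂ ν) := by
  obtain ⟨e, k₀, k₁, k₂, l₀, l₁, l₂, he, hk₀, hk₁, hk₂, hl₀, hl₁, hl₂, hT⟩ := hT.swap
  let I := ContinuousLinearMap.id ℝ F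
  refine ⟨fun x => ∫ θ in c..d, I ∘L e (θ, x), fun x => ∫ θ in c..d, I ∘L l₀ (θ, x),
    fun q => ∫ θ in c..d, I ∘L l₁ (θ, q), fun q => ∫ θ in c..d, I ∘L l₂ (θ, q),
    fun q => (I ∘L k₀ q + ∫ η in q.2..d, I ∘L k₁ (q.1, η, q.2)) +
      ∫ θ in c..d, I ∘L k₂ (q.1, θ, q.2), ?_, ?_, ?_, ?_, ?_, fun v u₁ u₂ h₁ h₂ x => ?_⟩
  rotate_right
  · have c₁ : Continuous fun θ => ∫ η in θ..d, I ∘L k₁ (x, η, θ) :=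
      continuous_intervalIntegral_of_continuous (by fun_prop) (by fun_prop) (by fun_prop)
    have c₂ : Continuous fun η => ∫ θ in c..d, I ∘L k₂ (x, θ, η) :=
      continuous_intervalIntegral_of_continuous (by fun_prop) (by fun_prop) (by fun_prop)
    have key := integral_eq (a := c) (b := d) (c := a) (d := b) (K := fun _ => I)
      he hk₀ hk₁ hk₂ hl₀ hl₁ hl₂ continuous_const v h₂ h₁ d x
    simp_rw [← hT v u₂ u₁ h₂ h₁] at key
    rw [← intervalIntegral.integral_add (Continuous.intervalIntegrable (by fun_prop) _ _)
      (Continuous.intervalIntegrable (by fun_prop) _ _)] at key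
    refine key.trans ?_
    simp only [_root_.add_apply]
    abel
  · exact continuous_intervalIntegral_of_continuous (by fun_prop) (by fun_prop) (by fun_prop)
  · exact continuous_intervalIntegral_of_continuous (by fun_prop) (by fun_prop) (by fun_prop)
  · exact continuous_intervalIntegral_of_continuous (by fun_prop) (by fun_prop) (by fun_prop)
  · exact continuous_intervalIntegral_of_continuous (by fun_prop) (by fun_prop) (by fun_prop)
  · refine (Continuous.add (by fun_prop) ?_).add ?_ <;>
    exact continuous_intervalIntegral_of_continuous (by fun_prop) (by fun_prop) (by fun_prop)

/-- Integration over both variables. -/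
theorem exists_integral_integral (hT : IsPartialInt a b c d T) :
    ∃ (e : V →L[ℝ] F) (k l : ℝ → U →L[ℝ] F), Continuous k ∧ Continuous l ∧
      ∀ v u₁ u₂, Continuous u₁ → Continuous u₂ → ∫ x in a..b, ∫ y in c..d, T v u₁ u₂ x y =
        e v + (∫ θ in a..b, k θ (u₁ θ)) + ∫ ν in c..d, l ν (u₂ ν) := by
  obtain ⟨e, k₀, k₁, k₂, l, he, hk₀, hk₁, hk₂, hl, hT⟩ := hT.exists_integral_snd
  let I := ContinuousLinearMap.id ℝ F
  have c₁ : Continuous fun θ => ∫ η in θ..b, I ∘L k₁ (η, θ) :=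
    continuous_intervalIntegral_of_continuous (by fun_prop) (by fun_prop) (by fun_prop)
  have c₂ : Continuous fun η => ∫ θ in a..b, I ∘L k₂ (θ, η) :=
    continuous_intervalIntegral_of_continuous (by fun_prop) (by fun_prop) (by fun_prop)
  have c₃ : Continuous fun ν => ∫ x in a..b, l (x, ν) :=
    continuous_intervalIntegral_of_continuous (by fun_prop) (by fun_prop) (by fun_prop)
  refine ⟨∫ x in a..b, e x, fun θ => (I ∘L k₀ θ + ∫ η in θ..b, I ∘L k₁ (η, θ)) +
    ∫ x in a..b, I ∘L k₂ (x, θ), fun ν => ∫ x in a..b, l (x, ν), by fun_prop, c₃,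
    fun v u₁ u₂ h₁ h₂ => ?_⟩
  have c₄ : Continuous fun x => ∫ ν in c..d, l (x, ν) (u₂ ν) :=
    continuous_intervalIntegral_of_continuous (by fun_prop) (by fun_prop) (by fun_prop)
  have c₅ : Continuous fun x => partialInt a b k₀ k₁ k₂ u₁ x :=
    continuous_partialInt (by fun_prop) (by fun_prop) (by fun_prop) h₁ continuous_id _ _
  have key := integral_clm_partialInt (k := fun _ => I) continuous_const hk₀ hk₁ hk₂ h₁ a b b
  rw [← intervalIntegral.integral_add (Continuous.intervalIntegrable (by fun_prop) _ _)
    (Continuous.intervalIntegrable (by fun_prop) _ _)] at key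
  have hswap : ∀ ν, (∫ x in a..b, l (x, ν)) (u₂ ν) = ∫ x in a..b, l (x, ν) (u₂ ν) := fun ν =>
    ContinuousLinearMap.intervalIntegral_apply
      (Continuous.intervalIntegrable (by fun_prop) _ _) _
  simp_rw [hT v u₁ u₂ h₁ h₂]
  rw [intervalIntegral.integral_add, intervalIntegral.integral_add,
    integral_integral_swap_of_continuous (f := fun q => l q (u₂ q.2)) (by fun_prop),
    ContinuousLinearMap.intervalIntegral_apply]
  · simp_rw [hswap]
    congr 2
  all_goals exact Continuous.intervalIntegrable (by fun_prop) _ _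

end IsPartialInt

end PartialIntegral

section Matrix

/-- Matrices as continuous linear maps. -/
def matrixCLM (p r : ℕ) : Matrix (Fin p) (Fin r) ℝ ≃ₗ[ℝ] ((Fin r → ℝ) →L[ℝ] (Fin p → ℝ)) :=
  Matrix.toLin' ≪≫ₗ LinearMap.toContinuousLinearMap

variable {p r : ℕ}

theorem matrixCLM_apply (M : Matrix (Fin p) (Fin r) ℝ) (v : Fin r → ℝ) :
    matrixCLM p r M v = M *ᵥ v := rfl

theorem matrixCLM_symm_mulVec (f : (Fin r → ℝ) →L[ℝ] (Fin p → ℝ)) (v : Fin r → ℝ) :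
    (matrixCLM p r).symm f *ᵥ v = f v := by
  rw [← matrixCLM_apply, LinearEquiv.apply_symm_apply]

theorem continuous_matrixCLM : Continuous (matrixCLM p r) :=
  LinearMap.continuous_of_finiteDimensional (matrixCLM p r).toLinearMap

theorem continuous_matrixCLM_symm : Continuous (matrixCLM p r).symm :=
  LinearMap.continuous_of_finiteDimensional (matrixCLM p r).symm.toLinearMap

end Matrix

section Clamp

/-- The nearest-point retraction of the line onto `[a, b]`. -/
def clamp (a b x : ℝ) : ℝ := max a (min b x)

variable {a b c d : ℝ}

theorem continuous_clamp : Continuous (clamp a b) := by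
  unfold clamp
  fun_prop

theorem clamp_mem (hab : a ≤ b) (x : ℝ) : clamp a b x ∈ Icc a b :=
  ⟨le_max_left _ _, max_le hab (min_le_left _ _)⟩

theorem clamp_of_mem {x : ℝ} (hx : x ∈ Icc a b) : clamp a b x = x := by
  rw [clamp, min_eq_right hx.2, max_eq_right hx.1]

theorem continuous_comp_clamp {X : Type*} [TopologicalSpace X] {f : ℝ → X} (hab : a ≤ b)
    (hf : ContinuousOn f (Icc a b)) : Continuous fun x => f (clamp a b x) :=
  hf.comp_continuous continuous_clamp (clamp_mem hab)

variable {p r : ℕ}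

/-- Continuous extension of a kernel in two variables. -/
def extendKernel₂ (a b c d : ℝ) (M : ℝ → ℝ → Matrix (Fin p) (Fin r) ℝ) (q : ℝ × ℝ) :
    (Fin r → ℝ) →L[ℝ] (Fin p → ℝ) :=
  matrixCLM p r (M (clamp a b q.1) (clamp c d q.2))

/-- Continuous extension of a kernel in three variables. -/
def extendKernel₃ (a b c d s t : ℝ) (M : ℝ → ℝ → ℝ → Matrix (Fin p) (Fin r) ℝ)
    (q : ℝ × ℝ × ℝ) : (Fin r → ℝ) →L[ℝ] (Fin p → ℝ) :=
  matrixCLM p r (M (clamp a b q.1) (clamp c d q.2.1) (clamp s t q.2.2))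

theorem continuous_extendKernel₂ (hab : a ≤ b) (hcd : c ≤ d)
    {M : ℝ → ℝ → Matrix (Fin p) (Fin r) ℝ}
    (hM : ContinuousOn (fun q : ℝ × ℝ => M q.1 q.2) (Icc a b ×ˢ Icc c d)) :
    Continuous (extendKernel₂ a b c d M) :=
  continuous_matrixCLM.comp <| hM.comp_continuous
    (f := fun q : ℝ × ℝ => (clamp a b q.1, clamp c d q.2))
    ((continuous_clamp.comp continuous_fst).prodMk (continuous_clamp.comp continuous_snd))
    fun q => ⟨clamp_mem hab _, clamp_mem hcd _⟩

theorem continuous_extendKernel₃ {s t : ℝ} (hab : a ≤ b) (hcd : c ≤ d) (hst : s ≤ t)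
    {M : ℝ → ℝ → ℝ → Matrix (Fin p) (Fin r) ℝ}
    (hM : ContinuousOn (fun q : ℝ × ℝ × ℝ => M q.1 q.2.1 q.2.2)
      (Icc a b ×ˢ Icc c d ×ˢ Icc s t)) :
    Continuous (extendKernel₃ a b c d s t M) :=
  continuous_matrixCLM.comp <| hM.comp_continuous
    (f := fun q : ℝ × ℝ × ℝ => (clamp a b q.1, clamp c d q.2.1, clamp s t q.2.2))
    ((continuous_clamp.comp continuous_fst).prodMk
      ((continuous_clamp.comp (continuous_fst.comp continuous_snd)).prodMk
        (continuous_clamp.comp (continuous_snd.comp continuous_snd))))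
    fun q => ⟨clamp_mem hab _, clamp_mem hcd _, clamp_mem hst _⟩

theorem extendKernel₂_apply (M : ℝ → ℝ → Matrix (Fin p) (Fin r) ℝ) {x y : ℝ}
    (hx : x ∈ Icc a b) (hy : y ∈ Icc c d) (v : Fin r → ℝ) :
    extendKernel₂ a b c d M (x, y) v = M x y *ᵥ v := by
  simp only [extendKernel₂, clamp_of_mem hx, clamp_of_mem hy, matrixCLM_apply]

theorem extendKernel₃_apply {s t : ℝ} (M : ℝ → ℝ → ℝ → Matrix (Fin p) (Fin r) ℝ) {x y z : ℝ}
    (hx : x ∈ Icc a b) (hy : y ∈ Icc c d) (hz : z ∈ Icc s t) (v : Fin r → ℝ) :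
    extendKernel₃ a b c d s t M (x, y, z) v = M x y z *ᵥ v := by
  simp only [extendKernel₃, clamp_of_mem hx, clamp_of_mem hy, clamp_of_mem hz, matrixCLM_apply]

theorem integral_congr_Icc {G : Type*} [NormedAddCommGroup G] [NormedSpace ℝ G] {f g : ℝ → G}
    (h : ∀ θ ∈ Icc a b, f θ = g θ) {s t : ℝ} (hs : s ∈ Icc a b) (ht : t ∈ Icc a b) :
    ∫ θ in s..t, f θ = ∫ θ in s..t, g θ :=
  intervalIntegral.integral_congr fun θ hθ => h θ (uIcc_subset_Icc hs ht hθ)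

/-- Comparison of `partialInt` with the form in which the kernels act on `[a, x]` and `[x, b]`. -/
theorem mulVec_add_integral_eq_partialInt {k₀ : ℝ → (Fin r → ℝ) →L[ℝ] (Fin p → ℝ)}
    {k₁ k₂ : ℝ × ℝ → (Fin r → ℝ) →L[ℝ] (Fin p → ℝ)} (hk₁ : Continuous k₁) (hk₂ : Continuous k₂)
    {u w : ℝ → Fin r → ℝ} (hw : Continuous w) (huw : ∀ θ ∈ Icc a b, u θ = w θ)
    {A₀ : Matrix (Fin p) (Fin r) ℝ} {A₁ A₂ : ℝ → Matrix (Fin p) (Fin r) ℝ} {x : ℝ}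
    (hx : x ∈ Icc a b) (h₀ : ∀ v, A₀ *ᵥ v = k₀ x v)
    (h₁ : ∀ θ ∈ Icc a b, ∀ v, A₁ θ *ᵥ v = k₁ (x, θ) v + k₂ (x, θ) v)
    (h₂ : ∀ θ ∈ Icc a b, ∀ v, A₂ θ *ᵥ v = k₂ (x, θ) v) :
    A₀ *ᵥ u x + (∫ θ in a..x, A₁ θ *ᵥ u θ) + (∫ θ in x..b, A₂ θ *ᵥ u θ) =
      partialInt a b k₀ k₁ k₂ w x := by
  have hab : a ≤ b := hx.1.trans hx.2
  have e₁ : ∫ θ in a..x, A₁ θ *ᵥ u θ = ∫ θ in a..x, (k₁ (x, θ) (w θ) + k₂ (x, θ) (w θ)) :=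
    integral_congr_Icc (fun θ hθ => by rw [h₁ θ hθ, huw θ hθ]) (left_mem_Icc.2 hab) hx
  have e₂ : ∫ θ in x..b, A₂ θ *ᵥ u θ = ∫ θ in x..b, k₂ (x, θ) (w θ) :=
    integral_congr_Icc (fun θ hθ => by rw [h₂ θ hθ, huw θ hθ]) hx (right_mem_Icc.2 hab)
  have hi : ∀ s t, IntervalIntegrable (fun θ => k₂ (x, θ) (w θ)) volume s t := fun s t =>
    Continuous.intervalIntegrable (by fun_prop) _ _
  rw [partialInt, e₁, e₂, h₀, huw x hx, intervalIntegral.integral_add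
      (Continuous.intervalIntegrable (by fun_prop) _ _) (hi _ _),
    ← intervalIntegral.integral_add_adjacent_intervals (hi a x) (hi x b)]
  abel

end Clamp

theorem PI1D_eq_partialInt {p r : ℕ} {a b : ℝ} {k₀ : ℝ → (Fin r → ℝ) →L[ℝ] (Fin p → ℝ)}
    {k₁ k₂ : ℝ × ℝ → (Fin r → ℝ) →L[ℝ] (Fin p → ℝ)} (hk₁ : Continuous k₁) (hk₂ : Continuous k₂)
    {u w : ℝ → Fin r → ℝ} (hw : Continuous w) (huw : ∀ θ ∈ Icc a b, u θ = w θ) {x : ℝ}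
    (hx : x ∈ Icc a b) :
    PI1D a b ⟨fun x => (matrixCLM p r).symm (k₀ x),
      fun x θ => (matrixCLM p r).symm (k₁ (x, θ) + k₂ (x, θ)),
      fun x θ => (matrixCLM p r).symm (k₂ (x, θ))⟩ u x = partialInt a b k₀ k₁ k₂ w x :=
  mulVec_add_integral_eq_partialInt hk₁ hk₂ hw huw hx (fun v => matrixCLM_symm_mulVec _ v)
    (fun θ _ v => matrixCLM_symm_mulVec _ v) (fun θ _ v => matrixCLM_symm_mulVec _ v)

theorem isCont_symm_matrixCLM {p r : ℕ} {a b : ℝ} {k₀ : ℝ → (Fin r → ℝ) →L[ℝ] (Fin p → ℝ)}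
    {k₁ k₂ : ℝ × ℝ → (Fin r → ℝ) →L[ℝ] (Fin p → ℝ)} (hk₀ : Continuous k₀)
    (hk₁ : Continuous k₁) (hk₂ : Continuous k₂) :
    PI1DK.IsCont a b ⟨fun x => (matrixCLM p r).symm (k₀ x),
      fun x θ => (matrixCLM p r).symm (k₁ (x, θ) + k₂ (x, θ)),
      fun x θ => (matrixCLM p r).symm (k₂ (x, θ))⟩ :=
  ⟨(continuous_matrixCLM_symm.comp hk₀).continuousOn,
    (continuous_matrixCLM_symm.comp (hk₁.add hk₂)).continuousOn,
    (continuous_matrixCLM_symm.comp hk₂).continuousOn⟩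

/-- On the rectangle, `PI011to2D` agrees with an operator whose kernels are continuous on the
whole plane. -/
theorem exists_isPartialInt_eq_PI011to2D {p r₀ r₁ : ℕ} {a b c d : ℝ} (hab : a ≤ b) (hcd : c ≤ d)
    {E : PI011to2DK p r₀ r₁} (hE : E.IsCont a b c d) :
    ∃ T : (Fin r₀ → ℝ) → (ℝ → Fin r₁ → ℝ) → (ℝ → Fin r₁ → ℝ) → ℝ → ℝ → Fin p → ℝ,
      IsPartialInt a b c d T ∧ ∀ v u₁ u₂ w₁ w₂, Continuous w₁ → Continuous w₂ →
        (∀ x ∈ Icc a b, u₁ x = w₁ x) → (∀ y ∈ Icc c d, u₂ y = w₂ y) →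
        ∀ x ∈ Icc a b, ∀ y ∈ Icc c d, PI011to2D a b c d E v u₁ u₂ x y = T v w₁ w₂ x y := by
  obtain ⟨h0, h10, h11, h12, h20, h21, h22⟩ := hE
  have h0 := continuous_extendKernel₂ hab hcd h0
  have h10 := continuous_extendKernel₂ hab hcd h10
  have h11 := continuous_extendKernel₃ hab hcd hab h11
  have h12 := continuous_extendKernel₃ hab hcd hab h12
  have h20 := continuous_extendKernel₂ hab hcd h20
  have h21 := continuous_extendKernel₃ hab hcd hcd h21
  have h22 := continuous_extendKernel₃ hab hcd hcd h22
  refine ⟨_, ⟨extendKernel₂ a b c d E.e0, fun q => extendKernel₂ a b c d E.e10 (q.2, q.1),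
    fun q => extendKernel₃ a b c d a b E.e11 (q.2.1, q.1, q.2.2) -
      extendKernel₃ a b c d a b E.e12 (q.2.1, q.1, q.2.2),
    fun q => extendKernel₃ a b c d a b E.e12 (q.2.1, q.1, q.2.2),
    extendKernel₂ a b c d E.e20,
    fun q => extendKernel₃ a b c d c d E.e21 q - extendKernel₃ a b c d c d E.e22 q,
    extendKernel₃ a b c d c d E.e22,
    h0, by fun_prop, by fun_prop, by fun_prop, by fun_prop, by fun_prop, by fun_prop,
    fun v u₁ u₂ _ _ x y => rfl⟩, fun v u₁ u₂ w₁ w₂ hw₁ hw₂ huw₁ huw₂ x hx y hy => ?_⟩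
  rw [← mulVec_add_integral_eq_partialInt (A₀ := E.e10 x y) (A₁ := E.e11 x y) (A₂ := E.e12 x y)
      (by fun_prop) (by fun_prop) hw₁ huw₁ hx,
    ← mulVec_add_integral_eq_partialInt (A₀ := E.e20 x y) (A₁ := E.e21 x y) (A₂ := E.e22 x y)
      (by fun_prop) (by fun_prop) hw₂ huw₂ hy, extendKernel₂_apply _ hx hy, PI011to2D]
  · abel
  · exact fun v => (extendKernel₂_apply _ hx hy v).symm
  · intro ν hν v
    rw [_root_.sub_apply, sub_add_cancel, extendKernel₃_apply _ hx hy hν]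
  · exact fun ν hν v => (extendKernel₃_apply _ hx hy hν v).symm
  · exact fun v => (extendKernel₂_apply _ hx hy v).symm
  · intro θ hθ v
    rw [_root_.sub_apply, sub_add_cancel, extendKernel₃_apply _ hx hy hθ]
  · exact fun θ hθ v => (extendKernel₃_apply _ hx hy hθ v).symm

/-- Composition of a (011→2D)-PI operator followed by a (2D→011)-PI
operator is a 011-PI operator. -/
theorem composition_2Dto011_after_011to2D {n0 n1 p2 m0 m1 : ℕ} (a b c d : ℝ)
    (hab : a < b) (hcd : c < d)
    (D : PI2Dto011K n0 n1 p2) (E : PI011to2DK p2 m0 m1)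
    (hD : D.IsCont a b c d) (hE : E.IsCont a b c d) :
    ∃ R : PI011K n0 n1 m0 m1, R.IsCont a b c d ∧
      ∀ (v : Fin m0 → ℝ) (u1 u2 : ℝ → Fin m1 → ℝ),
        ContinuousOn u1 (Icc a b) → ContinuousOn u2 (Icc c d) →
        (PI2Dto011 a b c d D (PI011to2D a b c d E v u1 u2)).1
          = (PI011 a b c d R v u1 u2).1 ∧
        (∀ x ∈ Icc a b,
          (PI2Dto011 a b c d D (PI011to2D a b c d E v u1 u2)).2.1 x
            = (PI011 a b c d R v u1 u2).2.1 x) ∧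
        (∀ y ∈ Icc c d,
          (PI2Dto011 a b c d D (PI011to2D a b c d E v u1 u2)).2.2 y
            = (PI011 a b c d R v u1 u2).2.2 y) := by
  have ha := left_mem_Icc.2 hab.le
  have hb := right_mem_Icc.2 hab.le
  have hc := left_mem_Icc.2 hcd.le
  have hd := right_mem_Icc.2 hcd.le
  obtain ⟨T, hT, hTE⟩ := exists_isPartialInt_eq_PI011to2D hab.le hcd.le hE
  obtain ⟨h0, h10, h11, h12, h20, h21, h22⟩ := hD
  have h0 := continuous_extendKernel₂ hab.le hcd.le h0
  have h10 := continuous_extendKernel₂ hab.le hcd.le h10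
  have h11 := continuous_extendKernel₃ hab.le hcd.le hab.le h11
  have h12 := continuous_extendKernel₃ hab.le hcd.le hab.le h12
  have h20 := continuous_extendKernel₂ hab.le hcd.le h20
  have h21 := continuous_extendKernel₃ hab.le hcd.le hcd.le h21
  have h22 := continuous_extendKernel₃ hab.le hcd.le hcd.le h22
  obtain ⟨e, k, l, hk, hl, hS⟩ := (hT.clm_apply h0).exists_integral_integral
  obtain ⟨e₁, k₀, k₁, k₂, l₁, he₁, hk₀, hk₁, hk₂, hl₁, hS₁⟩ :=
    (hT.comp_left h10 h11 h12).exists_integral_snd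
  obtain ⟨e₂, m₀, m₁, m₂, l₂, he₂, hm₀, hm₁, hm₂, hl₂, hS₂⟩ :=
    (hT.swap.comp_left (K₀ := fun q => extendKernel₂ a b c d D.d20 (q.2, q.1))
      (K₁ := fun q => extendKernel₃ a b c d c d D.d21 (q.2.1, q.1, q.2.2))
      (K₂ := fun q => extendKernel₃ a b c d c d D.d22 (q.2.1, q.1, q.2.2))
      (by fun_prop) (by fun_prop) (by fun_prop)).exists_integral_snd
  refine ⟨⟨(matrixCLM _ _).symm e, fun θ => (matrixCLM _ _).symm (k θ),
    fun ν => (matrixCLM _ _).symm (l ν), fun x => (matrixCLM _ _).symm (e₁ x),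
    fun y => (matrixCLM _ _).symm (e₂ y), fun x ν => (matrixCLM _ _).symm (l₁ (x, ν)),
    fun y θ => (matrixCLM _ _).symm (l₂ (y, θ)),
    ⟨fun x => (matrixCLM _ _).symm (k₀ x),
      fun x θ => (matrixCLM _ _).symm (k₁ (x, θ) + k₂ (x, θ)),
      fun x θ => (matrixCLM _ _).symm (k₂ (x, θ))⟩,
    ⟨fun y => (matrixCLM _ _).symm (m₀ y),
      fun y ν => (matrixCLM _ _).symm (m₁ (y, ν) + m₂ (y, ν)),
      fun y ν => (matrixCLM _ _).symm (m₂ (y, ν))⟩⟩,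
    ⟨(continuous_matrixCLM_symm.comp hk).continuousOn,
      (continuous_matrixCLM_symm.comp hl).continuousOn,
      (continuous_matrixCLM_symm.comp he₁).continuousOn,
      (continuous_matrixCLM_symm.comp he₂).continuousOn,
      (continuous_matrixCLM_symm.comp hl₁).continuousOn,
      (continuous_matrixCLM_symm.comp hl₂).continuousOn,
      isCont_symm_matrixCLM hk₀ hk₁ hk₂, isCont_symm_matrixCLM hm₀ hm₁ hm₂⟩,
    fun v u₁ u₂ hu₁ hu₂ => ?_⟩
  have hw₁ := continuous_comp_clamp hab.le hu₁
  have hw₂ := continuous_comp_clamp hcd.le hu₂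
  have huw₁ : ∀ x ∈ Icc a b, u₁ x = u₁ (clamp a b x) := fun x hx => by rw [clamp_of_mem hx]
  have huw₂ : ∀ y ∈ Icc c d, u₂ y = u₂ (clamp c d y) := fun y hy => by rw [clamp_of_mem hy]
  have hW := hTE v u₁ u₂ _ _ hw₁ hw₂ huw₁ huw₂
  refine ⟨?_, fun x hx => ?_, fun y hy => ?_⟩
  · refine Eq.trans (integral_congr_Icc (fun θ hθ => integral_congr_Icc (fun ν hν => ?_) hc hd)
      ha hb) ((hS v _ _ hw₁ hw₂).trans ?_)
    · rw [hW θ hθ ν hν, extendKernel₂_apply _ hθ hν]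
    · simp only [PI011, matrixCLM_symm_mulVec]
      rw [integral_congr_Icc (fun θ hθ => by rw [← huw₁ θ hθ]) ha hb,
        integral_congr_Icc (fun ν hν => by rw [← huw₂ ν hν]) hc hd]
  · refine Eq.trans (integral_congr_Icc (fun y hy => ?_) hc hd) ((hS₁ v _ _ hw₁ hw₂ x).trans ?_)
    · rw [hW x hx y hy, extendKernel₂_apply _ hx hy]
      congr 1
      · congr 1
        exact integral_congr_Icc (fun θ hθ => by
          rw [hW θ hθ y hy, extendKernel₃_apply _ hx hy hθ]) ha hx
      · exact integral_congr_Icc (fun θ hθ => by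
          rw [hW θ hθ y hy, extendKernel₃_apply _ hx hy hθ]) hx hb
    · simp only [PI011]
      rw [PI1D_eq_partialInt hk₁ hk₂ hw₁ huw₁ hx]
      simp only [matrixCLM_symm_mulVec]
      rw [integral_congr_Icc (fun ν hν => by rw [← huw₂ ν hν]) hc hd]
  · refine Eq.trans (integral_congr_Icc (fun x hx => ?_) ha hb) ((hS₂ v _ _ hw₂ hw₁ y).trans ?_)
    · rw [hW x hx y hy, extendKernel₂_apply _ hx hy]
      congr 1
      · congr 1
        exact integral_congr_Icc (fun ν hν => by
          rw [hW x hx ν hν, extendKernel₃_apply _ hx hy hν]) hc hy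
      · exact integral_congr_Icc (fun ν hν => by
          rw [hW x hx ν hν, extendKernel₃_apply _ hx hy hν]) hy hd
    · simp only [PI011]
      rw [PI1D_eq_partialInt hm₁ hm₂ hw₂ huw₂ hy]
      simp only [matrixCLM_symm_mulVec]
      rw [integral_congr_Icc (fun θ hθ => by rw [← huw₁ θ hθ]) ha hb]
      abel
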